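/- arXiv:1804.04372 — 4 statements merged into one kernel-verified Lean document; each statement's English description precedes it below -/
import Mathlib

section
/- For all real numbers x > 0, ν > 0 and n ∈ [0,1] such that x(x+1) > 2·n·min(1,ν), one has ν(1+2/x) / (1 − 2·n·min(1,ν)/(x(x+1))) ≥ ν(1 + 2/(x − n·min(1,ν))). (In particular both denominators are positive under these hypotheses.) -/
/-- First inequality of Lemma 4 (budget-sequence invariant): for x > 0, ν > 0,
n ∈ [0,1] with x(x+1) > 2·n·min(1,ν), the losing-step invariant holds
(and both denominators are positive). -/
theorem stmt_0 (x ν n : ℝ) (hx : 0 < x) (hν : 0 < ν) (hn0 : 0 ≤ n) (hn1 : n ≤ 1)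
    (h : x * (x + 1) > 2 * n * min 1 ν) :
    0 < 1 - 2 * n * min 1 ν / (x * (x + 1)) ∧ 0 < x - n * min 1 ν ∧
    ν * (1 + 2 / x) / (1 - 2 * n * min 1 ν / (x * (x + 1))) ≥
      ν * (1 + 2 / (x - n * min 1 ν)) := by
  have hm0 : 0 < min 1 ν := lt_min one_pos hν
  have hm1 : min 1 ν ≤ 1 := min_le_left 1 ν
  rw [mul_assoc] at h ⊢
  have ht0 : 0 ≤ n * min 1 ν := mul_nonneg hn0 hm0.le
  have ht1 : n * min 1 ν ≤ 1 := mul_le_one₀ hn1 hm0.le hm1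
  generalize n * min 1 ν = t at *
  have hxt : 0 < x - t := by
    by_contra! hle
    nlinarith
  have hxx : 0 < x * (x + 1) := by positivity
  have hden : 0 < x * (x + 1) - 2 * t := sub_pos.mpr h
  refine ⟨sub_pos.mpr ((div_lt_one hxx).mpr h), hxt, ?_⟩
  have hl : (1 + 2 / x) / (1 - 2 * t / (x * (x + 1))) =
      (x + 2) * (x + 1) / (x * (x + 1) - 2 * t) := by
    rw [one_add_div hx.ne', one_sub_div hxx.ne', div_div_div_eq,
      div_eq_div_iff (by positivity) hden.ne']
    ring
  rw [ge_iff_le, mul_div_assoc, hl, one_add_div hxt.ne']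
  refine mul_le_mul_of_nonneg_left ?_ hν.le
  rw [div_le_div_iff₀ hxt hden]
  nlinarith [mul_nonneg ht0 (sub_nonneg.mpr ht1)]
end

section
/- For all real numbers x > 0, ν > 0 and n ∈ [0,1], one has ν(1+2/x) − 2·n·min(1,ν)/(x(x+1)) ≥ ν(1 + 2/(x + n·min(1,ν⁻¹))). -/
/-- Second inequality of Lemma 4 (budget-sequence invariant): the winning-step
invariant of the budget walk. -/
theorem stmt_1 (x ν n : ℝ) (hx : 0 < x) (hν : 0 < ν) (hn0 : 0 ≤ n) (hn1 : n ≤ 1) :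
    ν * (1 + 2 / x) - 2 * n * min 1 ν / (x * (x + 1)) ≥
      ν * (1 + 2 / (x + n * min 1 ν⁻¹)) := by
  have hmin : min 1 ν = ν * min 1 ν⁻¹ := by
    rw [mul_min_of_nonneg _ _ hν.le, mul_one, mul_inv_cancel₀ hν.ne', min_comm]
  have hm0 : 0 ≤ min 1 ν⁻¹ := le_min zero_le_one (inv_nonneg.2 hν.le)
  have ht0 : 0 ≤ n * min 1 ν⁻¹ := mul_nonneg hn0 hm0
  have ht1 : n * min 1 ν⁻¹ ≤ 1 := mul_le_one₀ hn1 hm0 (min_le_left _ _)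
  rw [hmin, show 2 * n * (ν * min 1 ν⁻¹) = 2 * ν * (n * min 1 ν⁻¹) by ring]
  generalize n * min 1 ν⁻¹ = t at ht0 ht1 ⊢
  have hxt : 0 < x + t := by positivity
  have hle : 2 * ν * t / (x * (x + 1)) ≤ 2 * ν * t / (x * (x + t)) := by gcongr
  have heq : ν * (1 + 2 / x) - ν * (1 + 2 / (x + t)) = 2 * ν * t / (x * (x + t)) := by
    field_simp
    ring
  linarith
end

section
/- Let V be a type, let w, Pot : V → ℝ, let succ⁺, succ⁻ : V → V, and let ν > 0 be a real number. Assume that for every v ∈ V, Pot(v) = (ν·Pot(succ⁺(v)) + Pot(succ⁻(v)))/(1+ν) + w(v), and define St(v) = (Pot(succ⁺(v)) − Pot(succ⁻(v)))/(1+ν). Let v₁, …, v_n (n ≥ 1) be a finite sequence in V such that for every 1 ≤ i < n, either v_{i+1} = succ⁺(v_i), or v_{i+1} ≠ succ⁺(v_i) and Pot(v_{i+1}) ≥ Pot(succ⁻(v_i)). Let W be the set of indices 1 ≤ i < n with v_{i+1} = succ⁺(v_i) and L the set of remaining indices 1 ≤ i < n; put I = Σ_{i∈W} St(v_i), G = Σ_{i∈L}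 St(v_i), and E = Σ_{1≤i<n} w(v_i). Then Pot(v₁) − Pot(v_n) ≤ E + ν·G − I. -/
/-- Lemma 3 of the paper: along a finite path v₁,…,v_n in which each step is
either a Max win (moving to succ⁺) or a Max loss (moving to a vertex whose
potential is at least that of succ⁻), the drop in potential is bounded by
the energy plus ν times the gains minus the investments. -/
theorem stmt_6 {V : Type*} [DecidableEq V] (w Pot St : V → ℝ) (succp succm : V → V) (ν : ℝ) (hν : 0 < ν)
    (hPot : ∀ u, Pot u = (ν * Pot (succp u) + Pot (succm u)) / (1 + ν) + w u)
    (hSt : ∀ u, St u = (Pot (succp u) - Pot (succm u)) / (1 + ν))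
    (n : ℕ) (hn : 1 ≤ n) (v : ℕ → V)
    (hstep : ∀ i, i + 1 < n →
      v (i + 1) = succp (v i) ∨
        (v (i + 1) ≠ succp (v i) ∧ Pot (succm (v i)) ≤ Pot (v (i + 1)))) :
    Pot (v 0) - Pot (v (n - 1)) ≤
      (∑ i ∈ Finset.range (n - 1), w (v i))
        + ν * (∑ i ∈ (Finset.range (n - 1)).filter (fun i => v (i + 1) ≠ succp (v i)), St (v i))
        - (∑ i ∈ (Finset.range (n - 1)).filter (fun i => v (i + 1) = succp (v i)), St (v i)) := by
  have hν' : 1 + ν ≠ 0 := by positivity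
  rw [← Finset.sum_range_sub' (fun i => Pot (v i)) (n - 1), Finset.sum_filter, Finset.sum_filter,
    Finset.mul_sum, ← Finset.sum_add_distrib, ← Finset.sum_sub_distrib]
  refine Finset.sum_le_sum fun i hi => ?_
  have hlt : i + 1 < n := by
    have := Finset.mem_range.mp hi
    omega
  rcases hstep i hlt with h | ⟨h, hle⟩
  · have key : Pot (v i) - Pot (succp (v i)) = w (v i) - St (v i) := by
      rw [hPot (v i), hSt (v i)]
      field_simp
      ring
    simp [h, key]
  · have key : Pot (v i) - Pot (succm (v i)) = w (v i) + ν * St (v i) := by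
      rw [hPot (v i), hSt (v i)]
      field_simp
      ring
    simp only [ne_eq, h, not_false_eq_true, if_true, if_false]
    linarith
end

section
/- Let f⁻, f⁺, x, y be real numbers with x > 0, y > 0, 0 ≤ f⁻ ≤ f⁺ ≤ 1, f⁻ < 1, and f⁺ > 0. Set f = f⁺/(1 − f⁻ + f⁺) and Δ = (f − f⁻)/(f·(1 − f⁻)), and suppose x/(x+y) = f. Then x + y − Δ·x > 0 and x/(x + y − Δ·x) = f⁺. -/
/-- Budget-update identity when Player 2 wins a bidding (Theorem 1). -/
theorem stmt_13 (fm fp x y : ℝ) (hx : 0 < x) (hy : 0 < y)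
    (hfm0 : 0 ≤ fm) (hle : fm ≤ fp) (hfp1 : fp ≤ 1) (hfm1 : fm < 1) (hfp0 : 0 < fp)
    (f Δ : ℝ) (hf : f = fp / (1 - fm + fp)) (hΔ : Δ = (f - fm) / (f * (1 - fm)))
    (hinv : x / (x + y) = f) :
    0 < x + y - Δ * x ∧ x / (x + y - Δ * x) = fp := by
  have hm : 0 < 1 - fm := sub_pos.mpr hfm1
  have hd : 0 < 1 - fm + fp := add_pos hm hfp0
  have hsum : x + y = x * (1 - fm + fp) / fp := by
    rw [hf, div_eq_div_iff (add_pos hx hy).ne' hd.ne'] at hinv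
    rw [eq_div_iff hfp0.ne']
    linarith
  have hΔ' : Δ = (fp - fm) / fp := by
    rw [hΔ, hf]
    field_simp
    ring
  have hrest : x + y - Δ * x = x / fp := by
    rw [hsum, hΔ']
    field_simp
    ring
  rw [hrest]
  exact ⟨div_pos hx hfp0, div_div_cancel₀ hx.ne'⟩
end
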